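/- arXiv:1207.3791 — 3 statements merged into one kernel-verified Lean document; each statement's English description precedes it below -/
import Mathlib

section
/- Let m, e ∈ ℝ with m > 0, let F : ℝ⁴ → ℝ⁴ be a linear map that is η-antisymmetric, let x : ℝ → ℝ⁴ be a C² curve, let ε : ℝ → ℝ satisfy ε(τ) < 1, set g_τ = (1 − ε(τ))·η and a²(τ) = η(ẍ(τ), ẍ(τ)), and assume the normalization g_τ(ẋ(τ), ẋ(τ)) = −1 and the equation of motion m·ẍ(τ) = e·F(ẋ(τ)) − (2/3)e²·a²(τ)·ẋ(τ) for all τ. Then for all τ the exact identity e²·η(F(ẋ(τ)), F(ẋ(τ))) = m²·a²(τ) + (1/(1 − ε(τ)))·((2/3)e²)²·(a²(τ))² holds; that is, the squared magnitude of the Lorentz force F_L² = e²·η(Fẋ, Fẋ) equals m²a² + (1/(1−ε))·((2/3)e²)²·(a²)². -/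
/-- The Minkowski bilinear form on `ℝ⁴`. -/
def eta (v w : Fin 4 → ℝ) : ℝ :=
  -(v 0 * w 0) + v 1 * w 1 + v 2 * w 2 + v 3 * w 3

/-- An `eta`-antisymmetric map sends every vector to an `eta`-orthogonal one. -/
lemma eta_map_self {F : (Fin 4 → ℝ) →ₗ[ℝ] (Fin 4 → ℝ)}
    (hF : ∀ v w, eta (F v) w = - eta v (F w)) (v : Fin 4 → ℝ) : eta (F v) v = 0 := by
  have hcomm : eta v (F v) = eta (F v) v := by unfold eta; ring
  linarith [hF v v]

lemma eta_smul_self (c : ℝ) (v : Fin 4 → ℝ) : eta (c • v) (c • v) = c ^ 2 * eta v v := by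
  simp only [eta, Pi.smul_apply, smul_eq_mul]
  ring

lemma eta_smul_sub_smul_self (b c : ℝ) (v w : Fin 4 → ℝ) :
    eta (b • v - c • w) (b • v - c • w)
      = b ^ 2 * eta v v - 2 * b * c * eta v w + c ^ 2 * eta w w := by
  simp only [eta, Pi.sub_apply, Pi.smul_apply, smul_eq_mul]
  ring

/-- for a solution of the equation of motion
`m·ẍ = e·F(ẋ) - (2/3)e²·a²·ẋ` with the normalization
`(1 - ε)·η(ẋ, ẋ) = -1`, the squared Lorentz force satisfies exactly
`e²·η(Fẋ, Fẋ) = m²·a² + (1/(1-ε))·((2/3)e²)²·(a²)²`. -/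
theorem stmt11 (m e : ℝ) (hm : 0 < m)
    (F : (Fin 4 → ℝ) →ₗ[ℝ] (Fin 4 → ℝ))
    (hF : ∀ v w, eta (F v) w = - eta v (F w))
    (x : ℝ → Fin 4 → ℝ) (hx : ContDiff ℝ 2 x)
    (ε : ℝ → ℝ) (hε1 : ∀ τ, ε τ < 1)
    (hnorm : ∀ τ, (1 - ε τ) * eta (deriv x τ) (deriv x τ) = -1)
    (heom : ∀ τ, m • deriv (deriv x) τ
      = e • F (deriv x τ)
        - ((2 / 3) * e ^ 2
            * eta (deriv (deriv x) τ) (deriv (deriv x) τ)) • deriv x τ) :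
    ∀ τ, e ^ 2 * eta (F (deriv x τ)) (F (deriv x τ))
      = m ^ 2 * eta (deriv (deriv x) τ) (deriv (deriv x) τ)
        + (1 / (1 - ε τ)) * ((2 / 3) * e ^ 2) ^ 2
            * (eta (deriv (deriv x) τ) (deriv (deriv x) τ)) ^ 2 := by
  intro τ
  have hε : 1 - ε τ ≠ 0 := (sub_pos.2 (hε1 τ)).ne'
  have hu : eta (deriv x τ) (deriv x τ) = -(1 / (1 - ε τ)) := by
    field_simp
    linarith [hnorm τ]
  have hsq := eta_smul_self m (deriv (deriv x) τ)
  rw [heom τ, eta_smul_sub_smul_self, eta_map_self hF, hu] at hsq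
  linear_combination hsq
end

section
/- Let m > 0 and K be real constants, let u, f, ε : ℝ → ℝ be functions with u(τ) ≥ 0 and ε(τ) < 1 for all τ, and suppose the pointwise relation f(τ)² = (1/(1 − ε(τ)))·K²·u(τ)² + m²·u(τ) holds for all τ. If f(τ) → 0 as τ → ∞, then u(τ) → 0 as τ → ∞. In particular the equation of motion admits no run-away solutions: if the external Lorentz force vanishes asymptotically, the squared acceleration vanishes asymptotically. -/
open Filter Topology

/-- no run-away solutions. If
`f(τ)² = (1/(1-ε(τ)))·K²·u(τ)² + m²·u(τ)` with `u ≥ 0`, `ε < 1`, and the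
Lorentz-force magnitude `f` vanishes asymptotically, then the squared
acceleration `u` vanishes asymptotically. -/
theorem stmt16 (m K : ℝ) (hm : 0 < m) (u f ε : ℝ → ℝ)
    (hu : ∀ τ, 0 ≤ u τ) (hε : ∀ τ, ε τ < 1)
    (hrel : ∀ τ, (f τ) ^ 2 = (1 / (1 - ε τ)) * K ^ 2 * (u τ) ^ 2 + m ^ 2 * u τ)
    (hf : Tendsto f atTop (𝓝 0)) :
    Tendsto u atTop (𝓝 0) := by
  have hlim : Tendsto (fun τ => (f τ) ^ 2 / m ^ 2) atTop (𝓝 0) := by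
    simpa using (hf.pow 2).div_const (m ^ 2)
  refine squeeze_zero hu (fun τ => ?_) hlim
  have hε' : 0 < 1 - ε τ := sub_pos.mpr (hε τ)
  have hnonneg : 0 ≤ (1 / (1 - ε τ)) * K ^ 2 * (u τ) ^ 2 := by positivity
  rw [le_div_iff₀ (by positivity), hrel τ]
  linarith
end

section
/- Let m, e ∈ ℝ, let F : ℝ⁴ → ℝ⁴ be a linear map that is η-antisymmetric, let x : ℝ → ℝ⁴ be a C² curve, let ε : ℝ → ℝ satisfy ε(τ) < 1, set g_τ = (1 − ε(τ))·η and a²(τ) = η(ẍ(τ), ẍ(τ)), and assume the normalization g_τ(ẋ(τ), ẋ(τ)) = −1 and the equation of motion m·ẍ(τ) = e·F(ẋ(τ)) − (2/3)e²·a²(τ)·ẋ(τ) for all τ. Then the mechanical power satisfies, exactly and for all τ: m·g_τ(ẍ(τ), ẋ(τ)) = (2/3)e²·a²(τ), i.e. m·(1 − ε(τ))·η(ẍ(τ), ẋ(τ)) = (2/3)e²·η(ẍ(τ), ẍ(τ)); in particular the equation of motion is compatible with the covariant Larmor power radiation law. -/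
theorem eta_comm (v w : Fin 4 → ℝ) : eta v w = eta w v := by
  simp only [eta]
  ring

theorem eta_sub_left (u v w : Fin 4 → ℝ) : eta (u - v) w = eta u w - eta v w := by
  simp only [eta, Pi.sub_apply]
  ring

theorem eta_smul_left (c : ℝ) (v w : Fin 4 → ℝ) : eta (c • v) w = c * eta v w := by
  simp only [eta, Pi.smul_apply, smul_eq_mul]
  ring

theorem eta_apply_self_of_antisymm {F : (Fin 4 → ℝ) → Fin 4 → ℝ}
    (hF : ∀ v w, eta (F v) w = - eta v (F w)) (v : Fin 4 → ℝ) : eta (F v) v = 0 := by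
  have h := hF v v
  rw [eta_comm v] at h
  linarith

/-- compatibility with the covariant Larmor power law: for a
solution of `m·ẍ = e·F(ẋ) - (2/3)e²·a²·ẋ` with `(1-ε)·η(ẋ, ẋ) = -1`, the
mechanical power satisfies exactly
`m·(1-ε)·η(ẍ, ẋ) = (2/3)e²·η(ẍ, ẍ)`. -/
theorem stmt17 (m e : ℝ)
    (F : (Fin 4 → ℝ) →ₗ[ℝ] (Fin 4 → ℝ))
    (hF : ∀ v w, eta (F v) w = - eta v (F w))
    (x : ℝ → Fin 4 → ℝ) (hx : ContDiff ℝ 2 x)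
    (ε : ℝ → ℝ) (hε1 : ∀ τ, ε τ < 1)
    (hnorm : ∀ τ, (1 - ε τ) * eta (deriv x τ) (deriv x τ) = -1)
    (heom : ∀ τ, m • deriv (deriv x) τ
      = e • F (deriv x τ)
        - ((2 / 3) * e ^ 2
            * eta (deriv (deriv x) τ) (deriv (deriv x) τ)) • deriv x τ) :
    ∀ τ, m * ((1 - ε τ) * eta (deriv (deriv x) τ) (deriv x τ))
      = (2 / 3) * e ^ 2 * eta (deriv (deriv x) τ) (deriv (deriv x) τ) := by
  intro τ
  have hFv : eta (F (deriv x τ)) (deriv x τ) = 0 := eta_apply_self_of_antisymm hF _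
  have hpower := congrArg (fun u => eta u (deriv x τ)) (heom τ)
  simp only [eta_sub_left, eta_smul_left, hFv] at hpower
  linear_combination (1 - ε τ) * hpower
    - (2 / 3) * e ^ 2 * eta (deriv (deriv x) τ) (deriv (deriv x) τ) * hnorm τ
end
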